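/- arXiv:2209.05272 — 2 statements merged into one kernel-verified Lean document; each statement's English description precedes it below -/
import Mathlib

section
/- Let V_in > 0, L > 0, T_off > 0, let V_e1 < V_e2 be the initial and final equilibrium output voltages, I_e1, I_e2 ∈ ℝ the corresponding equilibrium peak currents, σ_d^v ≥ 0, and N_t ≥ 1 a natural number. Suppose sequences v, i_p, t_on : ℕ → ℝ satisfy, for every 1 ≤ n ≤ N_t, the per-cycle inductor current-balance relation (V_in/L)·t_on[n] − ((v[n] − V_in)/L)·T_off = i_p[n] − i_p[n−1], with boundary values i_p[0] = I_e1 and i_p[N_t] = I_e2, and suppose the sampled-voltage overshoot bound v[k] ≤ V_e1 + σ_d^v·(V_e2 − V_e1) holds for all 1 ≤ k ≤ N_t. Then the settling time T_t = Σ_{k=1}^{N_t}(T_off + t_on[k]) is bounded by a linear function of the number of settling cycles N_t: T_t ≤ ρ·N_t + γ, where ρ = (V_e1/V_in)·T_off + σ_d^v·((V_e2 − V_e1)/V_in)·T_off and γ = (L/V_in)·(I_e2 − I_e1). -/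
/-- The current-balance relation turns a bound on the sampled voltage of a cycle into a bound on
the duration of that cycle. -/
theorem cycle_duration_le {Vin L Toff ton v V Δi : ℝ} (hVin : 0 < Vin) (hL : 0 < L)
    (hToff : 0 ≤ Toff) (hbal : (Vin / L) * ton - ((v - Vin) / L) * Toff = Δi) (hv : v ≤ V) :
    Toff + ton ≤ (V / Vin) * Toff + (L / Vin) * Δi := by
  have hcycle : Toff + ton = (v / Vin) * Toff + (L / Vin) * Δi := by
    rw [← hbal]
    field_simp
    ring
  rw [hcycle]
  gcongr

/-- For a COT-CM boost converter undergoing a reference step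
`V_e1 → V_e2`, if the per-cycle inductor current-balance relation holds for every cycle
`1 ≤ n ≤ N_t`, with boundary peak currents `i_p[0] = I_e1`, `i_p[N_t] = I_e2`, and the sampled
voltages satisfy the overshoot bound `v[k] ≤ V_e1 + σ_d^v·(V_e2 − V_e1)`, then the settling
time `T_t = Σ_{k=1}^{N_t}(T_off + t_on[k])` is bounded linearly in the settling cycles `N_t`:
`T_t ≤ ρ·N_t + γ` with `ρ = (V_e1/V_in)·T_off + σ_d^v·((V_e2 − V_e1)/V_in)·T_off` and
`γ = (L/V_in)·(I_e2 − I_e1)`. -/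
theorem settling_time_bound
    (Vin L Toff Ve1 Ve2 Ie1 Ie2 σdv : ℝ) (Nt : ℕ)
    (hVin : 0 < Vin) (hL : 0 < L) (hToff : 0 < Toff)
    (hV : Ve1 < Ve2) (hσ : 0 ≤ σdv) (hNt : 1 ≤ Nt)
    (v ip ton : ℕ → ℝ)
    (hbal : ∀ n, 1 ≤ n → n ≤ Nt →
      (Vin / L) * ton n - ((v n - Vin) / L) * Toff = ip n - ip (n - 1))
    (hip0 : ip 0 = Ie1) (hipN : ip Nt = Ie2)
    (hos : ∀ k, 1 ≤ k → k ≤ Nt → v k ≤ Ve1 + σdv * (Ve2 - Ve1)) :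
    (∑ k ∈ Finset.Icc 1 Nt, (Toff + ton k)) ≤
      ((Ve1 / Vin) * Toff + σdv * ((Ve2 - Ve1) / Vin) * Toff) * (Nt : ℝ)
        + (L / Vin) * (Ie2 - Ie1) := by
  have hcycle : ∀ k ∈ Finset.Icc 1 Nt, Toff + ton k ≤
      ((Ve1 + σdv * (Ve2 - Ve1)) / Vin) * Toff + (L / Vin) * (ip k - ip (k - 1)) := by
    intro k hk
    obtain ⟨h1, hN⟩ := Finset.mem_Icc.mp hk
    exact cycle_duration_le hVin hL hToff.le (hbal k h1 hN) (hos k h1 hN)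
  have htelescope : ∑ k ∈ Finset.Icc 1 Nt, (ip k - ip (k - 1)) = ip Nt - ip 0 := by
    clear hcycle hbal hos hipN hNt
    induction Nt with
    | zero => simp
    | succ m ih => rw [Finset.sum_Icc_succ_top (by omega), ih, Nat.add_sub_cancel]; ring
  refine (Finset.sum_le_sum hcycle).trans_eq ?_
  rw [Finset.sum_add_distrib, Finset.sum_const, ← Finset.mul_sum, htelescope, hip0, hipN,
    Nat.card_Icc, Nat.add_sub_cancel, nsmul_eq_mul]
  ring
end

section
/- Let R, C, T_off > 0 and λ ∈ (0,1), set α = T_off/(RC) and α_c = (1−λ)·α, and assume α_c ≤ 1. Let V_e1 < V_e2 with I_e1 = V_e1/R and I_e2 = V_e2/R. Let v[N] = max_n v[n] be the maximum output-voltage sample and i_p[K] = max_n i_p[n] the maximum peak inductor current, and define σ_d^v = (v[N] − V_e2)/(V_e2 − V_e1) and σ_d^i = (i_p[K] − I_e2)/(I_e2 − I_e1). Suppose the continuous-time output voltage v(t) attains its maximum at t_m, define σ_t^v = (v(t_m) − V_e2)/(V_e2 − V_e1), and suppose t_m lies in a switching cycle with sampling instant s at which v(s) = v[M] ≤ v[N],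 with t_m ∈ [s, s + (1−λ)T_off]; suppose further that on [s, s + (1−λ)T_off] the output voltage is differentiable and satisfies the capacitor equation C·v′(t) = i_L(t) − v(t)/R, where the inductor current satisfies i_L(t) ≤ i_p[K], the capacitor is charging (i_L(t) ≥ v(t)/R), and v(t) ≥ v[M]. Then the continuous-time overshoot is bounded by the overshoots in the switching-synchronized sampled-state space: σ_t^v ≤ (1 − (1−λ)α)·σ_d^v + (1−λ)α·σ_d^i. -/
/-- (Overshoot theorem.) For a closed-loop COT-CM boost converter undergoing
a reference step `V_e1 → V_e2`, the continuous-time output-voltage overshoot `σ_t^v` is bounded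
by the overshoots in the switching-synchronized sampled-state space:
`σ_t^v ≤ (1 − (1−λ)α)·σ_d^v + (1−λ)α·σ_d^i`, where `α = T_off/(RC)`. -/
theorem continuous_overshoot_bound
    (R C Toff lam : ℝ) (hR : 0 < R) (hC : 0 < C) (hToff : 0 < Toff)
    (hlam : lam ∈ Set.Ioo (0 : ℝ) 1)
    (α αc : ℝ) (hα : α = Toff / (R * C)) (hαc : αc = (1 - lam) * α) (hαc1 : αc ≤ 1)
    (Ve1 Ve2 Ie1 Ie2 : ℝ) (hV : Ve1 < Ve2) (hIe1 : Ie1 = Ve1 / R) (hIe2 : Ie2 = Ve2 / R)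
    -- sampled data: `vd n` is the output-voltage sample and `ip n` the peak inductor
    -- current of the `n`-th cycle; the maxima are attained at `N` and `K`
    (vd ip : ℕ → ℝ) (N K : ℕ)
    (hvdN : ∀ n, vd n ≤ vd N) (hipK : ∀ n, ip n ≤ ip K)
    (σdv σdi : ℝ)
    (hσdv : σdv = (vd N - Ve2) / (Ve2 - Ve1))
    (hσdi : σdi = (ip K - Ie2) / (Ie2 - Ie1))
    -- continuous-time output voltage `v`, inductor current `iL`; `v` attains its maximum at `tm`
    (v iL : ℝ → ℝ) (tm : ℝ) (hmax : ∀ t, v t ≤ v tm)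
    (σtv : ℝ) (hσtv : σtv = (v tm - Ve2) / (Ve2 - Ve1))
    -- `tm` lies in a switching cycle with sampling instant `s`, `v(s) = vd[M] ≤ vd[N]`
    (M : ℕ) (s : ℝ) (hs : v s = vd M)
    (htm : tm ∈ Set.Icc s (s + (1 - lam) * Toff))
    -- on `[s, s + (1−λ)T_off]` the capacitor equation `C·v′ = i_L − v/R` holds,
    -- the inductor current is below the maximum peak current, the capacitor is charging,
    -- and the voltage stays above the sample `vd[M]`
    (hode : ∀ t ∈ Set.Icc s (s + (1 - lam) * Toff),
      HasDerivWithinAt v ((iL t - v t / R) / C) (Set.Icc s (s + (1 - lam) * Toff)) t)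
    (hiL : ∀ t ∈ Set.Icc s (s + (1 - lam) * Toff), iL t ≤ ip K)
    (hcharge : ∀ t ∈ Set.Icc s (s + (1 - lam) * Toff), v t / R ≤ iL t)
    (hlow : ∀ t ∈ Set.Icc s (s + (1 - lam) * Toff), vd M ≤ v t) :
    σtv ≤ (1 - (1 - lam) * α) * σdv + (1 - lam) * α * σdi := by
  have hΔ : 0 < Ve2 - Ve1 := sub_pos.2 hV
  have hlen : 0 < (1 - lam) * Toff := mul_pos (sub_pos.2 hlam.2) hToff
  have hsmem : s ∈ Set.Icc s (s + (1 - lam) * Toff) := ⟨le_rfl, by linarith⟩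
  have hslope : 0 ≤ (ip K - vd M / R) / C := by
    have h := (hcharge s hsmem).trans (hiL s hsmem)
    rw [hs] at h
    exact div_nonneg (sub_nonneg.2 h) hC.le
  have hderiv : ∀ t ∈ Set.Icc s (s + (1 - lam) * Toff),
      ‖(iL t - v t / R) / C‖ ≤ (ip K - vd M / R) / C := by
    intro t ht
    rw [Real.norm_of_nonneg (div_nonneg (sub_nonneg.2 (hcharge t ht)) hC.le)]
    have hvR : vd M / R ≤ v t / R := div_le_div_of_nonneg_right (hlow t ht) hR.le
    exact div_le_div_of_nonneg_right (by linarith [hiL t ht]) hC.le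
  have hmvt := (convex_Icc s (s + (1 - lam) * Toff)).norm_image_sub_le_of_norm_hasDerivWithin_le
    hode hderiv hsmem htm
  rw [Real.norm_of_nonneg (sub_nonneg.2 htm.1), hs] at hmvt
  have hrise : v tm - vd M ≤ (ip K - vd M / R) / C * ((1 - lam) * Toff) :=
    (le_abs_self _).trans
      (hmvt.trans (mul_le_mul_of_nonneg_left (by linarith [htm.2]) hslope))
  have hαc_rise : (ip K - vd M / R) / C * ((1 - lam) * Toff) = αc * (R * ip K - vd M) := by
    rw [hαc, hα]
    field_simp
  have hsample : (1 - αc) * vd M ≤ (1 - αc) * vd N :=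
    mul_le_mul_of_nonneg_left (hvdN M) (sub_nonneg.2 hαc1)
  have hσdi' : σdi = (R * ip K - Ve2) / (Ve2 - Ve1) := by
    rw [hσdi, hIe1, hIe2, ← sub_div, ← mul_div_mul_left _ _ hR.ne', mul_sub,
      mul_div_cancel₀ _ hR.ne', mul_div_cancel₀ _ hR.ne']
  rw [← hαc, hσtv, hσdv, hσdi', ← mul_div_assoc, ← mul_div_assoc, ← add_div]
  refine div_le_div_of_nonneg_right ?_ hΔ.le
  linarith
end
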